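/- arXiv:1812.00754 — 3 statements merged into one kernel-verified Lean document; each statement's English description precedes it below -/
import Mathlib

section
/- In the setting of the preceding identity (θ ∈ (0,1]; real A, B, C, D, E, F; G, Φ, Ψ as defined; λ : U → ℂ differentiable on an open interval U, avoiding (−∞, 0], with G(λ(τ), τ) = 0 on U), suppose additionally that τ₀ ∈ U, λ(τ₀) = iω₀ with ω₀ > 0, and Ψ(iω₀, τ₀) ≠ 0. Write Φ₁ = Re Φ(iω₀, τ₀), Φ₂ = Im Φ(iω₀, τ₀), Ψ₁ = Re Ψ(iω₀, τ₀), Ψ₂ = Im Ψ(iω₀, τ₀). Then Re λ'(τ₀) = (Φ₁Ψ₁ + Φ₂Ψ₂)/(Ψ₁² + Ψ₂²). In particular, if (Φ₁Ψ₁ + Φ₂Ψ₂)/(Ψ₁² + Ψ₂²) ≠ 0, then Re λ'(τ₀) ≠ 0 (the transversality condition of Lemma 3.2). -/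
open Real Complex

/-- The left-hand side `G(λ,τ)` of the characteristic equation (303). -/
noncomputable def charG (θ A B C D E F : ℝ) (lam : ℂ) (τ : ℝ) : ℂ :=
  lam ^ ((6 * θ : ℝ) : ℂ) +
    (A : ℂ) * Complex.exp (-(lam * (τ : ℂ))) * lam ^ ((5 * θ : ℝ) : ℂ) +
    (B : ℂ) * Complex.exp (-(2 * lam * (τ : ℂ))) * lam ^ ((4 * θ : ℝ) : ℂ) +
    (C : ℂ) * Complex.exp (-(3 * lam * (τ : ℂ))) * lam ^ ((3 * θ : ℝ) : ℂ) +
    (D : ℂ) * Complex.exp (-(4 * lam * (τ : ℂ))) * lam ^ ((2 * θ : ℝ) : ℂ) +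
    (E : ℂ) * Complex.exp (-(5 * lam * (τ : ℂ))) * lam ^ ((θ : ℝ) : ℂ) +
    (F : ℂ) * Complex.exp (-(6 * lam * (τ : ℂ)))

/-- The numerator `Φ(λ,τ)` in the implicit-differentiation step of Lemma 3.2. -/
noncomputable def charPhi (θ A B C D E F : ℝ) (lam : ℂ) (τ : ℝ) : ℂ :=
  lam * ((A : ℂ) * Complex.exp (-(lam * (τ : ℂ))) * lam ^ ((5 * θ : ℝ) : ℂ) +
    2 * (B : ℂ) * Complex.exp (-(2 * lam * (τ : ℂ))) * lam ^ ((4 * θ : ℝ) : ℂ) +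
    3 * (C : ℂ) * Complex.exp (-(3 * lam * (τ : ℂ))) * lam ^ ((3 * θ : ℝ) : ℂ) +
    4 * (D : ℂ) * Complex.exp (-(4 * lam * (τ : ℂ))) * lam ^ ((2 * θ : ℝ) : ℂ) +
    5 * (E : ℂ) * Complex.exp (-(5 * lam * (τ : ℂ))) * lam ^ ((θ : ℝ) : ℂ) +
    6 * (F : ℂ) * Complex.exp (-(6 * lam * (τ : ℂ))))

/-- The denominator `Ψ(λ,τ)` in the implicit-differentiation step of Lemma 3.2. -/
noncomputable def charPsi (θ A B C D E F : ℝ) (lam : ℂ) (τ : ℝ) : ℂ :=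
  6 * (θ : ℂ) * lam ^ ((6 * θ - 1 : ℝ) : ℂ) +
    (A : ℂ) * (5 * (θ : ℂ) * lam ^ ((5 * θ - 1 : ℝ) : ℂ) - (τ : ℂ) * lam ^ ((5 * θ : ℝ) : ℂ)) *
      Complex.exp (-(lam * (τ : ℂ))) +
    (B : ℂ) * (4 * (θ : ℂ) * lam ^ ((4 * θ - 1 : ℝ) : ℂ) -
        2 * (τ : ℂ) * lam ^ ((4 * θ : ℝ) : ℂ)) * Complex.exp (-(2 * lam * (τ : ℂ))) +
    (C : ℂ) * (3 * (θ : ℂ) * lam ^ ((3 * θ - 1 : ℝ) : ℂ) -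
        3 * (τ : ℂ) * lam ^ ((3 * θ : ℝ) : ℂ)) * Complex.exp (-(3 * lam * (τ : ℂ))) +
    (D : ℂ) * (2 * (θ : ℂ) * lam ^ ((2 * θ - 1 : ℝ) : ℂ) -
        4 * (τ : ℂ) * lam ^ ((2 * θ : ℝ) : ℂ)) * Complex.exp (-(4 * lam * (τ : ℂ))) +
    (E : ℂ) * ((θ : ℂ) * lam ^ ((θ - 1 : ℝ) : ℂ) -
        5 * (τ : ℂ) * lam ^ ((θ : ℝ) : ℂ)) * Complex.exp (-(5 * lam * (τ : ℂ))) -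
    6 * (F : ℂ) * (τ : ℂ) * Complex.exp (-(6 * lam * (τ : ℂ)))


theorem aux_pow (lam : ℝ → ℂ) (l' : ℂ) (t c : ℝ) (h : HasDerivAt lam l' t)
    (hs : lam t ∈ Complex.slitPlane) :
    HasDerivAt (fun x => lam x ^ (c : ℂ)) (l' * ((c : ℂ) * lam t ^ ((c - 1 : ℝ) : ℂ))) t := by
  have h1 : HasDerivAt (fun z : ℂ => z ^ (c : ℂ)) ((c : ℂ) * lam t ^ ((c : ℂ) - 1) * 1) (lam t) :=
    (hasDerivAt_id (lam t)).cpow_const hs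
  have h2 := h1.scomp t h
  rw [mul_one, smul_eq_mul] at h2
  rw [Complex.ofReal_sub, Complex.ofReal_one]
  exact h2

theorem aux_exp (lam : ℝ → ℂ) (l' : ℂ) (t : ℝ) (n : ℂ) (h : HasDerivAt lam l' t) :
    HasDerivAt (fun x : ℝ => Complex.exp (-(n * lam x * (x : ℂ))))
      (Complex.exp (-(n * lam t * (t : ℂ))) * (-(n * l' * t + n * lam t))) t := by
  have h0 : HasDerivAt (fun x : ℝ => (x : ℂ)) 1 t := Complex.ofRealCLM.hasDerivAt
  have h2 := (((h.const_mul n).mul h0).neg).cexp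
  simpa using h2

/-- Transversality condition of Lemma 3.2: at a purely imaginary root `λ(τ₀) = iω₀`
with `Ψ(iω₀,τ₀) ≠ 0`, the real part of `λ'(τ₀)` equals
`(Φ₁Ψ₁ + Φ₂Ψ₂)/(Ψ₁² + Ψ₂²)`; in particular it is nonzero under assumption (H4). -/
theorem transversality_tau3 (θ A B C D E F : ℝ) (hθ0 : 0 < θ) (hθ1 : θ ≤ 1)
    (a b : ℝ) (lam lam' : ℝ → ℂ)
    (hslit : ∀ τ ∈ Set.Ioo a b, lam τ ∈ Complex.slitPlane)
    (hderiv : ∀ τ ∈ Set.Ioo a b, HasDerivAt lam (lam' τ) τ)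
    (hroot : ∀ τ ∈ Set.Ioo a b, charG θ A B C D E F (lam τ) τ = 0)
    (τ₀ ω₀ : ℝ) (hτ₀ : τ₀ ∈ Set.Ioo a b) (hω₀ : 0 < ω₀)
    (hlam0 : lam τ₀ = Complex.I * (ω₀ : ℂ))
    (hΨ : charPsi θ A B C D E F (Complex.I * (ω₀ : ℂ)) τ₀ ≠ 0) :
    (lam' τ₀).re =
        ((charPhi θ A B C D E F (Complex.I * (ω₀ : ℂ)) τ₀).re *
            (charPsi θ A B C D E F (Complex.I * (ω₀ : ℂ)) τ₀).re +
          (charPhi θ A B C D E F (Complex.I * (ω₀ : ℂ)) τ₀).im *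
            (charPsi θ A B C D E F (Complex.I * (ω₀ : ℂ)) τ₀).im) /
        ((charPsi θ A B C D E F (Complex.I * (ω₀ : ℂ)) τ₀).re ^ 2 +
          (charPsi θ A B C D E F (Complex.I * (ω₀ : ℂ)) τ₀).im ^ 2) ∧
      (((charPhi θ A B C D E F (Complex.I * (ω₀ : ℂ)) τ₀).re *
            (charPsi θ A B C D E F (Complex.I * (ω₀ : ℂ)) τ₀).re +
          (charPhi θ A B C D E F (Complex.I * (ω₀ : ℂ)) τ₀).im *
            (charPsi θ A B C D E F (Complex.I * (ω₀ : ℂ)) τ₀).im) /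
        ((charPsi θ A B C D E F (Complex.I * (ω₀ : ℂ)) τ₀).re ^ 2 +
          (charPsi θ A B C D E F (Complex.I * (ω₀ : ℂ)) τ₀).im ^ 2) ≠ 0 →
        (lam' τ₀).re ≠ 0) := by
  have hs := hslit τ₀ hτ₀
  have hd := hderiv τ₀ hτ₀
  have key : lam' τ₀ * charPsi θ A B C D E F (lam τ₀) τ₀ = charPhi θ A B C D E F (lam τ₀) τ₀ := by
    have p := fun c => aux_pow lam _ τ₀ c hd hs
    have e := fun n => aux_exp lam _ τ₀ n hd
    have hG := ((((((p (6 * θ)).add (((e 1).const_mul (A : ℂ)).mul (p (5 * θ)))).add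
      (((e 2).const_mul (B : ℂ)).mul (p (4 * θ)))).add
      (((e 3).const_mul (C : ℂ)).mul (p (3 * θ)))).add
      (((e 4).const_mul (D : ℂ)).mul (p (2 * θ)))).add
      (((e 5).const_mul (E : ℂ)).mul (p θ))).add ((e 6).const_mul (F : ℂ))
    have h0 : HasDerivAt (fun _ : ℝ => (0 : ℂ)) 0 τ₀ := hasDerivAt_const _ _
    have hz := h0.congr_of_eventuallyEq (f₁ := fun t => charG θ A B C D E F (lam t) t)
      (Filter.eventually_of_mem (isOpen_Ioo.mem_nhds hτ₀) hroot)
    have hG' := hG.congr_of_eventuallyEq (f₁ := fun t => charG θ A B C D E F (lam t) t)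
      (Filter.Eventually.of_forall fun t => by simp [charG])
    have hu := hG'.unique hz
    simp only [one_mul] at hu
    unfold charPsi charPhi
    push_cast at hu ⊢
    linear_combination hu
  rw [hlam0] at key
  generalize charPsi θ A B C D E F (Complex.I * (ω₀ : ℂ)) τ₀ = P at *
  generalize charPhi θ A B C D E F (Complex.I * (ω₀ : ℂ)) τ₀ = Q at *
  have main : (lam' τ₀).re = (Q.re * P.re + Q.im * P.im) / (P.re ^ 2 + P.im ^ 2) := by
    have hP : P.re ^ 2 + P.im ^ 2 ≠ 0 := by
      have := (Complex.normSq_pos.2 hΨ).ne'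
      rw [Complex.normSq_apply] at this
      intro h; apply this; linarith
    rw [eq_div_iff hP, ← key, Complex.mul_re, Complex.mul_im]
    ring
  exact ⟨main, fun h => main ▸ h⟩
end

section
/- Let a₁, a₂, a₃, a₄, b₁, b₂, b₃ be real numbers and let u, v be real numbers with u² + v² = 1. Define q₁ = 16(a₁a₃ + b₁b₃)² + 16(a₃b₁ − a₁b₃)², q₂ = 16(a₁a₃ + b₁b₃)·[a₂(a₁ + a₃) + b₂(b₁ + b₃)] + 16(a₃b₁ − a₁b₃)·[a₂(b₁ − b₃) + b₂(a₃ − a₁)], q₃ = 8(a₁a₃ + b₁b₃)·[a₂² + (a₃ − a₁)² − a₄² + (b₁ − b₃)² + b₂²] + 4[a₂(a₁ + a₃) + b₂(b₁ + b₃)]² + 4[a₂(b₁ − b₃) + b₂(a₃ − a₁)]² − 16(a₃b₁ − a₁b₃)², q₄ = 4[a₂(a₁ + a₃) + b₂(b₁ + b₃)]·[a₂² + (a₃ − a₁)² − a₄² + (b₁ − b₃)² + b₂²] − 16(a₃b₁ − a₁b₃)·[a₂(b₁ − b₃) + b₂(a₃ − a₁)], q₅ = [a₂² + (a₃ − a₁)²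 − a₄² + (b₁ − b₃)² + b₂²]² − 4[a₂(b₁ − b₃) + b₂(a₃ − a₁)]². If [(a₁ + a₃)u + (b₁ − b₃)v + a₂]² + [(b₁ + b₃)u + (a₃ − a₁)v + b₂]² = a₄², then q₁u⁴ + q₂u³ + q₃u² + q₄u + q₅ = 0. -/
/-- Reduction of equation (314) of the paper (with `u = cos(4ωτ₄)`,
`v = sin(4ωτ₄)`, `u² + v² = 1`) to the quartic equation (316)–(317) in `u`. -/
theorem quartic_reduction (a₁ a₂ a₃ a₄ b₁ b₂ b₃ u v : ℝ) (huv : u ^ 2 + v ^ 2 = 1)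
    (q₁ q₂ q₃ q₄ q₅ : ℝ)
    (hq₁ : q₁ = 16 * (a₁ * a₃ + b₁ * b₃) ^ 2 + 16 * (a₃ * b₁ - a₁ * b₃) ^ 2)
    (hq₂ : q₂ = 16 * (a₁ * a₃ + b₁ * b₃) * (a₂ * (a₁ + a₃) + b₂ * (b₁ + b₃)) +
        16 * (a₃ * b₁ - a₁ * b₃) * (a₂ * (b₁ - b₃) + b₂ * (a₃ - a₁)))
    (hq₃ : q₃ = 8 * (a₁ * a₃ + b₁ * b₃) *
          (a₂ ^ 2 + (a₃ - a₁) ^ 2 - a₄ ^ 2 + (b₁ - b₃) ^ 2 + b₂ ^ 2) +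
        4 * (a₂ * (a₁ + a₃) + b₂ * (b₁ + b₃)) ^ 2 +
        4 * (a₂ * (b₁ - b₃) + b₂ * (a₃ - a₁)) ^ 2 -
        16 * (a₃ * b₁ - a₁ * b₃) ^ 2)
    (hq₄ : q₄ = 4 * (a₂ * (a₁ + a₃) + b₂ * (b₁ + b₃)) *
          (a₂ ^ 2 + (a₃ - a₁) ^ 2 - a₄ ^ 2 + (b₁ - b₃) ^ 2 + b₂ ^ 2) -
        16 * (a₃ * b₁ - a₁ * b₃) * (a₂ * (b₁ - b₃) + b₂ * (a₃ - a₁)))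
    (hq₅ : q₅ = (a₂ ^ 2 + (a₃ - a₁) ^ 2 - a₄ ^ 2 + (b₁ - b₃) ^ 2 + b₂ ^ 2) ^ 2 -
        4 * (a₂ * (b₁ - b₃) + b₂ * (a₃ - a₁)) ^ 2)
    (h : ((a₁ + a₃) * u + (b₁ - b₃) * v + a₂) ^ 2 +
        ((b₁ + b₃) * u + (a₃ - a₁) * v + b₂) ^ 2 = a₄ ^ 2) :
    q₁ * u ^ 4 + q₂ * u ^ 3 + q₃ * u ^ 2 + q₄ * u + q₅ = 0 := by
  obtain ⟨P, hP⟩ : ∃ P, P = a₁ * a₃ + b₁ * b₃ := ⟨_, rfl⟩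
  obtain ⟨D, hD⟩ : ∃ D, D = a₃ * b₁ - a₁ * b₃ := ⟨_, rfl⟩
  obtain ⟨R, hR⟩ : ∃ R, R = a₂ * (a₁ + a₃) + b₂ * (b₁ + b₃) := ⟨_, rfl⟩
  obtain ⟨S, hS⟩ : ∃ S, S = a₂ * (b₁ - b₃) + b₂ * (a₃ - a₁) := ⟨_, rfl⟩
  obtain ⟨T, hT⟩ : ∃ T, T = a₂ ^ 2 + (a₃ - a₁) ^ 2 - a₄ ^ 2 + (b₁ - b₃) ^ 2 + b₂ ^ 2 :=
    ⟨_, rfl⟩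
  have key : 4 * P * u ^ 2 + 2 * R * u + T + v * (4 * D * u + 2 * S) = 0 := by
    rw [hP, hD, hR, hS, hT]
    linear_combination h - ((a₃ - a₁) ^ 2 + (b₁ - b₃) ^ 2) * huv
  rw [← hP, ← hD] at hq₁
  rw [← hP, ← hD, ← hR, ← hS] at hq₂
  rw [← hP, ← hD, ← hR, ← hS, ← hT] at hq₃
  rw [← hD, ← hR, ← hS, ← hT] at hq₄
  rw [← hS, ← hT] at hq₅
  rw [hq₁, hq₂, hq₃, hq₄, hq₅]
  linear_combination (4 * P * u ^ 2 + 2 * R * u + T - v * (4 * D * u + 2 * S)) * key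
    + (4 * D * u + 2 * S) ^ 2 * huv
end

section
/- In the setting of the preceding identity (θ ∈ (0,1]; τ₁ ≥ 0; real coefficients; p₁, p₂, p₃, p₄ as defined; λ : U → ℂ differentiable on an open interval U, avoiding (−∞, 0], satisfying e^{−4λ(τ₄)τ₄}·p₁(λ(τ₄)) + p₂(λ(τ₄)) + e^{4λ(τ₄)τ₄}·p₃(λ(τ₄)) + e^{8λ(τ₄)τ₄}·p₄ = 0 on U), define Θ(λ, τ₄) = 4λ·e^{−4λτ₄}·p₁(λ) − 4λ·e^{4λτ₄}·p₃(λ) − 8λ·p₄·e^{8λτ₄} and Υ(λ, τ₄) = e^{−4λτ₄}·p₁'(λ) + p₂'(λ) + e^{4λτ₄}·p₃'(λ) − 4τ₄·e^{−4λτ₄}·p₁(λ) + 4τ₄·e^{4λτ₄}·p₃(λ) + 8τ₄·p₄·e^{8λτ₄}. Suppose τ₀* ∈ U, λ(τ₀*) = iω₀* with ω₀* > 0, and Υ(iω₀*, τ₀*) ≠ 0. Write Θ₁ = Re Θ(iω₀*, τ₀*), Θ₂ = Im Θ(iω₀*, τ₀*), Υ₁ = Re Υ(iω₀*, τ₀*),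 Υ₂ = Im Υ(iω₀*, τ₀*). Then Re λ'(τ₀*) = (Θ₁Υ₁ + Θ₂Υ₂)/(Υ₁² + Υ₂²); in particular, if (Θ₁Υ₁ + Θ₂Υ₂)/(Υ₁² + Υ₂²) ≠ 0, then Re λ'(τ₀*) ≠ 0 (the transversality condition of Lemma 3.3). -/
open Real Complex

/-- The polynomial-type expression `p₁(λ)` of the paper (Section 3.2). -/
noncomputable def pOne (θ τ₁ c11 c21 c31 c41 c51 c61 : ℝ) (lam : ℂ) : ℂ :=
  Complex.exp (6 * lam * (τ₁ : ℂ)) * lam ^ ((6 * θ : ℝ) : ℂ) +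
    (c11 : ℂ) * Complex.exp (5 * lam * (τ₁ : ℂ)) * lam ^ ((5 * θ : ℝ) : ℂ) +
    (c21 : ℂ) * Complex.exp (4 * lam * (τ₁ : ℂ)) * lam ^ ((4 * θ : ℝ) : ℂ) +
    (c31 : ℂ) * Complex.exp (3 * lam * (τ₁ : ℂ)) * lam ^ ((3 * θ : ℝ) : ℂ) +
    (c41 : ℂ) * Complex.exp (2 * lam * (τ₁ : ℂ)) * lam ^ ((2 * θ : ℝ) : ℂ) +
    (c51 : ℂ) * Complex.exp (lam * (τ₁ : ℂ)) * lam ^ ((θ : ℝ) : ℂ) + (c61 : ℂ)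

/-- The expression `p₂(λ)` of the paper (Section 3.2). -/
noncomputable def pTwo (θ τ₁ c22 c32 c42 c52 c62 : ℝ) (lam : ℂ) : ℂ :=
  -((c22 : ℂ) * Complex.exp (4 * lam * (τ₁ : ℂ)) * lam ^ ((4 * θ : ℝ) : ℂ) +
    (c32 : ℂ) * Complex.exp (3 * lam * (τ₁ : ℂ)) * lam ^ ((3 * θ : ℝ) : ℂ) +
    (c42 : ℂ) * Complex.exp (2 * lam * (τ₁ : ℂ)) * lam ^ ((2 * θ : ℝ) : ℂ) +
    (c52 : ℂ) * Complex.exp (lam * (τ₁ : ℂ)) * lam ^ ((θ : ℝ) : ℂ) + (c62 : ℂ))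

/-- The expression `p₃(λ)` of the paper (Section 3.2). -/
noncomputable def pThree (θ τ₁ c43 c44 c53 c54 c63 c64 : ℝ) (lam : ℂ) : ℂ :=
  ((c43 - c44 : ℝ) : ℂ) * Complex.exp (2 * lam * (τ₁ : ℂ)) * lam ^ ((2 * θ : ℝ) : ℂ) +
    ((c53 - c54 : ℝ) : ℂ) * Complex.exp (lam * (τ₁ : ℂ)) * lam ^ ((θ : ℝ) : ℂ) +
    ((c63 - c64 : ℝ) : ℂ)

/-- The numerator `Θ(λ,τ₄)` in the implicit-differentiation step of Lemma 3.3,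
with `p₄ = −c₆₅`. -/
noncomputable def bigTheta (θ τ₁ c11 c21 c31 c41 c51 c61 c43 c44 c53 c54 c63 c64 c65 : ℝ)
    (lam : ℂ) (τ₄ : ℝ) : ℂ :=
  4 * lam * Complex.exp (-(4 * lam * (τ₄ : ℂ))) * pOne θ τ₁ c11 c21 c31 c41 c51 c61 lam -
    4 * lam * Complex.exp (4 * lam * (τ₄ : ℂ)) * pThree θ τ₁ c43 c44 c53 c54 c63 c64 lam -
    8 * lam * ((-c65 : ℝ) : ℂ) * Complex.exp (8 * lam * (τ₄ : ℂ))

/-- The denominator `Υ(λ,τ₄)` in the implicit-differentiation step of Lemma 3.3,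
with the complex derivatives of `p₁, p₂, p₃` expressed via `deriv` and `p₄ = −c₆₅`. -/
noncomputable def bigUpsilon (θ τ₁ c11 c21 c22 c31 c32 c41 c42 c43 c44 c51 c52 c53 c54
    c61 c62 c63 c64 c65 : ℝ) (lam : ℂ) (τ₄ : ℝ) : ℂ :=
  Complex.exp (-(4 * lam * (τ₄ : ℂ))) * deriv (pOne θ τ₁ c11 c21 c31 c41 c51 c61) lam +
    deriv (pTwo θ τ₁ c22 c32 c42 c52 c62) lam +
    Complex.exp (4 * lam * (τ₄ : ℂ)) * deriv (pThree θ τ₁ c43 c44 c53 c54 c63 c64) lam -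
    4 * (τ₄ : ℂ) * Complex.exp (-(4 * lam * (τ₄ : ℂ))) *
      pOne θ τ₁ c11 c21 c31 c41 c51 c61 lam +
    4 * (τ₄ : ℂ) * Complex.exp (4 * lam * (τ₄ : ℂ)) *
      pThree θ τ₁ c43 c44 c53 c54 c63 c64 lam +
    8 * (τ₄ : ℂ) * ((-c65 : ℝ) : ℂ) * Complex.exp (8 * lam * (τ₄ : ℂ))

theorem aux_implicit (P Q R : ℂ → ℂ) (k : ℂ) (lam : ℝ → ℂ) (l' P' Q' R' : ℂ) (t : ℝ)
    (hl : HasDerivAt lam l' t) (hP : HasDerivAt P P' (lam t)) (hQ : HasDerivAt Q Q' (lam t))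
    (hR : HasDerivAt R R' (lam t))
    (h0 : (fun s : ℝ => Complex.exp (-(4 * lam s * (s : ℂ))) * P (lam s) + Q (lam s) +
        Complex.exp (4 * lam s * (s : ℂ)) * R (lam s) +
        Complex.exp (8 * lam s * (s : ℂ)) * k) =ᶠ[nhds t] fun _ => 0) :
    l' * (Complex.exp (-(4 * lam t * (t : ℂ))) * P' + Q' + Complex.exp (4 * lam t * (t : ℂ)) * R' -
      4 * (t : ℂ) * Complex.exp (-(4 * lam t * (t : ℂ))) * P (lam t) +
      4 * (t : ℂ) * Complex.exp (4 * lam t * (t : ℂ)) * R (lam t) +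
      8 * (t : ℂ) * k * Complex.exp (8 * lam t * (t : ℂ))) =
    4 * lam t * Complex.exp (-(4 * lam t * (t : ℂ))) * P (lam t) -
      4 * lam t * Complex.exp (4 * lam t * (t : ℂ)) * R (lam t) -
      8 * lam t * k * Complex.exp (8 * lam t * (t : ℂ)) := by
  have ht : HasDerivAt (fun s : ℝ => (s : ℂ)) 1 t := Complex.ofRealCLM.hasDerivAt
  have hP1 : HasDerivAt (fun s => P (lam s)) (P' * l') t := hP.comp t hl
  have hQ1 : HasDerivAt (fun s => Q (lam s)) (Q' * l') t := hQ.comp t hl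
  have hR1 : HasDerivAt (fun s => R (lam s)) (R' * l') t := hR.comp t hl
  have e1 := (((hl.const_mul 4).fun_mul ht).fun_neg).cexp
  have e2 := ((hl.const_mul 4).fun_mul ht).cexp
  have e3 := ((hl.const_mul 8).fun_mul ht).cexp
  have H := (((e1.fun_mul hP1).fun_add hQ1).fun_add (e2.fun_mul hR1)).fun_add (e3.mul_const k)
  have H0 := (hasDerivAt_const t (0 : ℂ)).congr_of_eventuallyEq h0
  have := H.unique H0
  linear_combination this

theorem aux_term (w z : ℂ) (hz : z ∈ Complex.slitPlane) :
    DifferentiableAt ℂ (fun z : ℂ => z ^ w) z :=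
  differentiableAt_id.cpow_const hz

theorem aux_div (l T U : ℂ) (hU : U ≠ 0) (h : l * U = T) :
    l.re = (T.re * U.re + T.im * U.im) / (U.re ^ 2 + U.im ^ 2) := by
  have hn : U.re ^ 2 + U.im ^ 2 ≠ 0 := by
    intro h0
    apply hU
    apply Complex.ext
    · simp only [Complex.zero_re]; nlinarith [sq_nonneg U.re, sq_nonneg U.im]
    · simp only [Complex.zero_im]; nlinarith [sq_nonneg U.re, sq_nonneg U.im]
  rw [eq_div_iff hn, ← h, Complex.mul_re, Complex.mul_im]
  ring

/-- Transversality condition of Lemma 3.3: at a purely imaginary root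
`λ(τ₀*) = iω₀*` with `Υ(iω₀*,τ₀*) ≠ 0`, the real part of `λ'(τ₀*)` equals
`(Θ₁Υ₁ + Θ₂Υ₂)/(Υ₁² + Υ₂²)`; in particular it is nonzero under assumption (H6). -/
theorem transversality_tau4 (θ τ₁ : ℝ) (hθ0 : 0 < θ) (hθ1 : θ ≤ 1) (hτ₁ : 0 ≤ τ₁)
    (c11 c21 c22 c31 c32 c41 c42 c43 c44 c51 c52 c53 c54 c61 c62 c63 c64 c65 : ℝ)
    (a b : ℝ) (lam lam' : ℝ → ℂ)
    (hslit : ∀ t ∈ Set.Ioo a b, lam t ∈ Complex.slitPlane)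
    (hderiv : ∀ t ∈ Set.Ioo a b, HasDerivAt lam (lam' t) t)
    (hroot : ∀ t ∈ Set.Ioo a b,
      Complex.exp (-(4 * lam t * (t : ℂ))) * pOne θ τ₁ c11 c21 c31 c41 c51 c61 (lam t) +
        pTwo θ τ₁ c22 c32 c42 c52 c62 (lam t) +
        Complex.exp (4 * lam t * (t : ℂ)) * pThree θ τ₁ c43 c44 c53 c54 c63 c64 (lam t) +
        Complex.exp (8 * lam t * (t : ℂ)) * ((-c65 : ℝ) : ℂ) = 0)
    (τ₀ ω₀ : ℝ) (hτ₀ : τ₀ ∈ Set.Ioo a b) (hω₀ : 0 < ω₀)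
    (hlam0 : lam τ₀ = Complex.I * (ω₀ : ℂ))
    (hΥ : bigUpsilon θ τ₁ c11 c21 c22 c31 c32 c41 c42 c43 c44 c51 c52 c53 c54
        c61 c62 c63 c64 c65 (Complex.I * (ω₀ : ℂ)) τ₀ ≠ 0) :
    (lam' τ₀).re =
        ((bigTheta θ τ₁ c11 c21 c31 c41 c51 c61 c43 c44 c53 c54 c63 c64 c65
              (Complex.I * (ω₀ : ℂ)) τ₀).re *
            (bigUpsilon θ τ₁ c11 c21 c22 c31 c32 c41 c42 c43 c44 c51 c52 c53 c54
              c61 c62 c63 c64 c65 (Complex.I * (ω₀ : ℂ)) τ₀).re +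
          (bigTheta θ τ₁ c11 c21 c31 c41 c51 c61 c43 c44 c53 c54 c63 c64 c65
              (Complex.I * (ω₀ : ℂ)) τ₀).im *
            (bigUpsilon θ τ₁ c11 c21 c22 c31 c32 c41 c42 c43 c44 c51 c52 c53 c54
              c61 c62 c63 c64 c65 (Complex.I * (ω₀ : ℂ)) τ₀).im) /
        ((bigUpsilon θ τ₁ c11 c21 c22 c31 c32 c41 c42 c43 c44 c51 c52 c53 c54
            c61 c62 c63 c64 c65 (Complex.I * (ω₀ : ℂ)) τ₀).re ^ 2 +
          (bigUpsilon θ τ₁ c11 c21 c22 c31 c32 c41 c42 c43 c44 c51 c52 c53 c54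
            c61 c62 c63 c64 c65 (Complex.I * (ω₀ : ℂ)) τ₀).im ^ 2) ∧
      (((bigTheta θ τ₁ c11 c21 c31 c41 c51 c61 c43 c44 c53 c54 c63 c64 c65
              (Complex.I * (ω₀ : ℂ)) τ₀).re *
            (bigUpsilon θ τ₁ c11 c21 c22 c31 c32 c41 c42 c43 c44 c51 c52 c53 c54
              c61 c62 c63 c64 c65 (Complex.I * (ω₀ : ℂ)) τ₀).re +
          (bigTheta θ τ₁ c11 c21 c31 c41 c51 c61 c43 c44 c53 c54 c63 c64 c65
              (Complex.I * (ω₀ : ℂ)) τ₀).im *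
            (bigUpsilon θ τ₁ c11 c21 c22 c31 c32 c41 c42 c43 c44 c51 c52 c53 c54
              c61 c62 c63 c64 c65 (Complex.I * (ω₀ : ℂ)) τ₀).im) /
        ((bigUpsilon θ τ₁ c11 c21 c22 c31 c32 c41 c42 c43 c44 c51 c52 c53 c54
            c61 c62 c63 c64 c65 (Complex.I * (ω₀ : ℂ)) τ₀).re ^ 2 +
          (bigUpsilon θ τ₁ c11 c21 c22 c31 c32 c41 c42 c43 c44 c51 c52 c53 c54
            c61 c62 c63 c64 c65 (Complex.I * (ω₀ : ℂ)) τ₀).im ^ 2) ≠ 0 →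
        (lam' τ₀).re ≠ 0) := by
  have hz := hslit τ₀ hτ₀
  have hP : DifferentiableAt ℂ (pOne θ τ₁ c11 c21 c31 c41 c51 c61) (lam τ₀) := by
    have := fun w => aux_term w _ hz
    unfold pOne
    fun_prop (disch := assumption)
  have hQ : DifferentiableAt ℂ (pTwo θ τ₁ c22 c32 c42 c52 c62) (lam τ₀) := by
    have := fun w => aux_term w _ hz
    unfold pTwo
    fun_prop (disch := assumption)
  have hR : DifferentiableAt ℂ (pThree θ τ₁ c43 c44 c53 c54 c63 c64) (lam τ₀) := by
    have := fun w => aux_term w _ hz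
    unfold pThree
    fun_prop (disch := assumption)
  have key := aux_implicit _ _ _ ((-c65 : ℝ) : ℂ) lam _ _ _ _ τ₀ (hderiv τ₀ hτ₀)
    hP.hasDerivAt hQ.hasDerivAt hR.hasDerivAt
    (by filter_upwards [isOpen_Ioo.mem_nhds hτ₀] with s hs using hroot s hs)
  rw [hlam0] at key
  have main := aux_div (lam' τ₀) _ _ hΥ key
  exact ⟨main, fun h => by rw [main]; exact h⟩
end
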